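/- Let S be a nonempty perfect Polish space, let f : S^k → S be continuous and nondegenerate (k ≥ 1), let H ⊆ S be nowhere dense, let F be a condition on S, and let s_1, …, s_k be pairwise incomparable finite binary strings (no one an initial segment of another, pairwise, and pairwise incompatible). Then there exists a condition F' with F ≤ F', with s_1, …, s_k all in the domain of F', and such that f( F'(s_1) × ⋯ × F'(s_k) ) ∩ H = ∅, i.e., for all x_1 ∈ F'(s_1), …, x_k ∈ F'(s_k) we have f(x_1, …, x_k) ∉ H. -/

import Mathlib

open Function Set

/-- A function `f : S^k → S` is *nondegenerate* if there is a coordinate `i` such that,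
for any fixed values of the other coordinates, the resulting one-variable function
is a homeomorphism of `S` onto `S`. -/
def Nondegenerate {S : Type*} [TopologicalSpace S] {k : ℕ} (f : (Fin k → S) → S) : Prop :=
  ∃ i : Fin k, ∀ a : Fin k → S, IsHomeomorph (fun x : S => f (Function.update a i x))

/-- A *condition* on a topological space `S`: a function from a finite, downward-closed
(under the initial-segment relation) set of finite binary strings to nonempty open subsets
of `S`, such that the values at the two immediate successors of a string are disjoint, and
such that extensions of strings are mapped to smaller open sets. -/
structure Condition (S : Type*) [TopologicalSpace S] where
  dom : Finset (List Bool)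
  downward_closed : ∀ s t : List Bool, s <+: t → t ∈ dom → s ∈ dom
  val : List Bool → Set S
  isOpen : ∀ s ∈ dom, IsOpen (val s)
  nonempty : ∀ s ∈ dom, (val s).Nonempty
  disjoint : ∀ s : List Bool, (s ++ [false]) ∈ dom → (s ++ [true]) ∈ dom →
      val (s ++ [false]) ∩ val (s ++ [true]) = ∅
  mono : ∀ s t : List Bool, s <+: t → t ∈ dom → val t ⊆ val s

/-- The extension order on conditions: `F ≤ F'` iff `dom F ⊆ dom F'` and `F'(s) ⊆ F(s)` for
every `s ∈ dom F`. -/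
def Condition.Le {S : Type*} [TopologicalSpace S] (F F' : Condition S) : Prop :=
  F.dom ⊆ F'.dom ∧ ∀ s ∈ F.dom, F'.val s ⊆ F.val s

/-- A subset of a power of `S` is dense if from every point one can reach it by arbitrarily small
changes of a single coordinate. -/
theorem dense_of_dense_update {S ι : Type*} [TopologicalSpace S] [DecidableEq ι] {A : Set (ι → S)}
    (h : ∀ p : ι → S, ∃ a, Dense {x : S | update p a x ∈ A}) : Dense A := by
  intro p
  obtain ⟨a, ha⟩ := h p
  have hc : Continuous (fun x : S => update p a x) := continuous_const.update a continuous_id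
  have := map_mem_closure hc (ha (p a)) (t := A) (fun x hx => hx)
  simpa using this

theorem dense_setOf_apply_ne {S ι : Type*} [TopologicalSpace S] [PerfectSpace S] [T1Space S]
    {a b : ι} (hab : a ≠ b) : Dense {p : ι → S | p a ≠ p b} := by
  classical
  refine dense_of_dense_update fun p => ⟨a, ?_⟩
  have : {x : S | update p a x ∈ {p : ι → S | p a ≠ p b}} = {p b}ᶜ := by
    ext x
    simp [update_of_ne hab.symm]
  rw [this]
  exact dense_compl_singleton _

theorem Nondegenerate.dense_preimage_comp {S ι : Type*} [TopologicalSpace S] {k : ℕ}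
    {f : (Fin k → S) → S} (hf : Nondegenerate f) {D : Set S} (hD : Dense D)
    {l : Fin k → ι} (hl : Injective l) : Dense {p : ι → S | f (p ∘ l) ∈ D} := by
  classical
  obtain ⟨i, hi⟩ := hf
  refine dense_of_dense_update fun p => ⟨l i, ?_⟩
  have : {x : S | update p (l i) x ∈ {p : ι → S | f (p ∘ l) ∈ D}} =
      (fun x => f (update (p ∘ l) i x)) ⁻¹' D := by
    ext x
    simp [update_comp_eq_of_injective _ hl]
  rw [this]
  exact hD.preimage (hi _).isOpenMap

/-- Open sets indexed by a finite type can be shrunk to pairwise disjoint ones such that `f` maps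
every product of `k` distinct members into a given open dense set. -/
theorem Nondegenerate.exists_shrinking {S ι : Type*} [TopologicalSpace S] [PolishSpace S]
    [PerfectSpace S] [Finite ι] {k : ℕ} {f : (Fin k → S) → S} (hf : Nondegenerate f)
    (hfc : Continuous f) {D : Set S} (hDo : IsOpen D) (hD : Dense D)
    {W : ι → Set S} (hWo : ∀ a, IsOpen (W a)) (hWn : ∀ a, (W a).Nonempty) :
    ∃ V : ι → Set S, (∀ a, IsOpen (V a)) ∧ (∀ a, (V a).Nonempty) ∧ (∀ a, V a ⊆ W a) ∧
      (Pairwise fun a b => Disjoint (V a) (V b)) ∧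
      ∀ l : Fin k → ι, Injective l → ∀ x : Fin k → S, (∀ i, x i ∈ V (l i)) → f x ∈ D := by
  classical
  let A : {q : ι × ι // q.1 ≠ q.2} → Set (ι → S) := fun q => {p | p q.1.1 ≠ p q.1.2}
  let B : {l : Fin k → ι // Injective l} → Set (ι → S) := fun l => {p | f (p ∘ l.1) ∈ D}
  have hAo : ∀ q, IsOpen (A q) := fun q =>
    isOpen_ne_fun (continuous_apply q.1.1) (continuous_apply q.1.2)
  have hBo : ∀ l, IsOpen (B l) := fun l => hDo.preimage
    (hfc.comp (continuous_pi fun i => continuous_apply (l.1 i)))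
  have hG : Dense ((⋂ q, A q) ∩ ⋂ l, B l) :=
    (dense_iInter_of_isOpen hAo fun q => dense_setOf_apply_ne q.2).inter_of_isOpen_right
      (dense_iInter_of_isOpen hBo fun l => hf.dense_preimage_comp hD l.2)
      (isOpen_iInter_of_finite hBo)
  have hGo : IsOpen ((⋂ q, A q) ∩ ⋂ l, B l) :=
    (isOpen_iInter_of_finite hAo).inter (isOpen_iInter_of_finite hBo)
  obtain ⟨p, hpW, hpG⟩ := hG.inter_open_nonempty (univ.pi W)
    (isOpen_set_pi finite_univ fun a _ => hWo a) (univ_pi_nonempty_iff.2 hWn)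
  obtain ⟨U, hU, hUG⟩ := isOpen_pi_iff'.1 hGo p hpG
  refine ⟨fun a => U a ∩ W a, fun a => (hU a).1.inter (hWo a),
    fun a => ⟨p a, (hU a).2, hpW a trivial⟩, fun a => inter_subset_right, ?_, ?_⟩
  · intro a b hab
    refine Set.disjoint_left.2 fun x hxa hxb => ?_
    have hq : update (update p a x) b x ∈ univ.pi U := by
      intro c _
      rcases eq_or_ne c b with rfl | hcb
      · simpa using hxb.1
      rcases eq_or_ne c a with rfl | hca
      · simpa [hcb] using hxa.1
      · simpa [hcb, hca] using (hU c).2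
    have := mem_iInter.1 (hUG hq).1 ⟨(a, b), hab⟩
    simp [A, hab] at this
  · intro l hl x hx
    have hq : extend l x p ∈ univ.pi U := by
      intro c _
      by_cases hc : ∃ i, l i = c
      · obtain ⟨i, rfl⟩ := hc
        simpa [hl.extend_apply] using (hx i).1
      · simpa [extend_apply' _ _ _ hc] using (hU c).2
    have := mem_iInter.1 (hUG hq).2 ⟨l, hl⟩
    simpa [B, extend_comp hl] using this

/-- The values of a condition at the initial segments of a string have a common point. -/
theorem Condition.nonempty_iInter_prefix {S : Type*} [TopologicalSpace S] [Nonempty S]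
    (F : Condition S) (t : List Bool) :
    (⋂ r ∈ F.dom.filter (· <+: t), F.val r).Nonempty := by
  rcases (F.dom.filter (· <+: t)).eq_empty_or_nonempty with h | h
  · simp [h]
  · obtain ⟨r, hr, hmax⟩ := Finset.exists_max_image _ List.length h
    obtain ⟨hrF, hrt⟩ := Finset.mem_filter.1 hr
    obtain ⟨x, hx⟩ := F.nonempty r hrF
    refine ⟨x, mem_iInter₂.2 fun r' hr' => F.mono r' r ?_ hrF hx⟩
    exact List.prefix_of_prefix_length_le (Finset.mem_filter.1 hr').2 hrt (hmax r' hr')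

/-- The condition on a given domain whose value at `t` is the union of a pairwise disjoint family
of open sets over all extensions of `t`. -/
def Condition.ofDisjoint {S : Type*} [TopologicalSpace S] (D : Finset (List Bool))
    (hD : ∀ s t : List Bool, s <+: t → t ∈ D → s ∈ D) (V : D → Set S)
    (hVo : ∀ a, IsOpen (V a)) (hVn : ∀ a, (V a).Nonempty)
    (hVd : Pairwise fun a b => Disjoint (V a) (V b)) : Condition S where
  dom := D
  downward_closed := hD
  val t := ⋃ (l : D) (_ : t <+: l.1), V l
  isOpen _ _ := isOpen_iUnion fun l => isOpen_iUnion fun _ => hVo l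
  nonempty t ht := (hVn ⟨t, ht⟩).mono (subset_iUnion₂_of_subset ⟨t, ht⟩ List.prefix_rfl subset_rfl)
  disjoint t _ _ := by
    refine Set.disjoint_iff_inter_eq_empty.1 ?_
    simp only [disjoint_iUnion_left, disjoint_iUnion_right]
    intro l hl m hm
    refine hVd ?_
    rintro rfl
    have := (List.prefix_of_prefix_length_le hl hm (by simp)).eq_of_length (by simp)
    simp at this
  mono _ _ hst _ := iUnion_mono fun _ => iUnion_mono' fun h => ⟨hst.trans h, subset_rfl⟩

/-- Let `S` be a nonempty perfect Polish space, `f : S^k → S` continuous and nondegenerate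
(`k ≥ 1`), `H ⊆ S` nowhere dense, `F` a condition on `S`, and `s_1, …, s_k` pairwise
incomparable finite binary strings.  Then there is a condition `F' ≥ F` whose domain contains
all the `s_i` such that `f(F'(s_1) × ⋯ × F'(s_k)) ∩ H = ∅`. -/
theorem stmt1 {S : Type*} [TopologicalSpace S] [PolishSpace S] [PerfectSpace S] [Nonempty S]
    {k : ℕ} (hk : 1 ≤ k)
    (f : (Fin k → S) → S) (hfc : Continuous f) (hfn : Nondegenerate f)
    (H : Set S) (hH : IsNowhereDense H)
    (F : Condition S)
    (s : Fin k → List Bool)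
    (hs : ∀ i j : Fin k, i ≠ j → ¬ (s i <+: s j)) :
    ∃ F' : Condition S, Condition.Le F F' ∧ (∀ i, s i ∈ F'.dom) ∧
      ∀ x : Fin k → S, (∀ i, x i ∈ F'.val (s i)) → f x ∉ H := by
  classical
  let D : Finset (List Bool) := F.dom ∪ Finset.univ.biUnion fun i => (s i).inits.toFinset
  have hsD : ∀ i, s i ∈ D := fun i => by
    simp only [D, Finset.mem_union, Finset.mem_biUnion, List.mem_toFinset, List.mem_inits]
    exact Or.inr ⟨i, Finset.mem_univ _, List.prefix_rfl⟩
  have hD : ∀ r t : List Bool, r <+: t → t ∈ D → r ∈ D := by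
    intro r t hrt ht
    simp only [D, Finset.mem_union, Finset.mem_biUnion, List.mem_toFinset, List.mem_inits] at ht ⊢
    exact ht.imp (F.downward_closed r t hrt) fun ⟨i, hi, h⟩ => ⟨i, hi, hrt.trans h⟩
  have hDense : Dense (closure H)ᶜ := interior_eq_empty_iff_dense_compl.1 hH
  obtain ⟨V, hVo, hVn, hVW, hVd, hVf⟩ := hfn.exists_shrinking hfc isClosed_closure.isOpen_compl
    hDense (W := fun t : D => ⋂ r ∈ F.dom.filter (· <+: t.1), F.val r)
    (fun t => isOpen_biInter_finset fun r hr => F.isOpen r (Finset.mem_filter.1 hr).1)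
    (fun t => F.nonempty_iInter_prefix t.1)
  refine ⟨Condition.ofDisjoint D hD V hVo hVn hVd, ⟨Finset.subset_union_left, fun t ht => ?_⟩,
    hsD, fun x hx hxH => ?_⟩
  · exact iUnion₂_subset fun l hl => (hVW l).trans
      (biInter_subset_of_mem (Finset.mem_filter.2 ⟨ht, hl⟩))
  · have hx' : ∀ i, ∃ l : D, s i <+: l.1 ∧ x i ∈ V l := fun i => by
      simpa only [Condition.ofDisjoint, mem_iUnion, exists_prop] using hx i
    choose l hsl hxl using hx'
    have hl : Injective l := by
      intro i j hij
      by_contra hne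
      rcases List.prefix_or_prefix_of_prefix (hsl i) (hij ▸ hsl j) with h | h
      · exact hs i j hne h
      · exact hs j i (Ne.symm hne) h
    exact hVf l hl x hxl (subset_closure hxH)
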